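/- arXiv:2408.04759 — 3 statements merged into one kernel-verified Lean document; each statement's English description precedes it below -/
import Mathlib

section
/- Let L_1, ..., L_n be i.i.d. random variables taking values in {0,1} with common mean R = E[L_1], let alpha in (0,1), and define the empirical risk R_hat = (1/n) * sum_{i=1}^n L_i and the p-value p = P(Bin(n, alpha) <= n * R_hat), where Bin(n, alpha) denotes a Binomial random variable with n trials and success probability alpha (the probability is the binomial CDF evaluated at the observed value n * R_hat, so p is a random variable through R_hat). If the null hypothesis holds, i.e. R > alpha, then p is super-uniform: for all u in (0,1), P(p <= u) <= u. -/
open MeasureTheory ProbabilityTheory Real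

/-- The CDF of a Binomial distribution with `n` trials and success probability `α`,
evaluated at a real point `x`: `P(Bin(n, α) ≤ x)`. -/
noncomputable def binomCdf (n : ℕ) (α : ℝ) (x : ℝ) : ℝ :=
  ∑ i ∈ Finset.range (n + 1),
    if (i : ℝ) ≤ x then (n.choose i : ℝ) * α ^ i * (1 - α) ^ (n - i) else 0

/-- Conditioning on the last trial of a binomial variable. -/
lemma binomCdf_succ (m : ℕ) (α x : ℝ) :
    binomCdf (m + 1) α x = (1 - α) * binomCdf m α x + α * binomCdf m α (x - 1) := by
  have hfail : (1 - α) * binomCdf m α x = ∑ i ∈ Finset.range (m + 2),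
      if (i : ℝ) ≤ x then (m.choose i : ℝ) * α ^ i * (1 - α) ^ (m + 1 - i) else 0 := by
    rw [Finset.sum_range_succ, Nat.choose_succ_self, binomCdf, Finset.mul_sum]
    simp only [Nat.cast_zero, zero_mul, ite_self, add_zero]
    refine Finset.sum_congr rfl fun i hi ↦ ?_
    rw [Nat.succ_sub (Nat.lt_succ_iff.mp (Finset.mem_range.mp hi)), pow_succ]
    split_ifs <;> ring
  rw [hfail, binomCdf, binomCdf, Finset.sum_range_succ', Finset.sum_range_succ' _ (m + 1),
    Finset.mul_sum, add_right_comm, ← Finset.sum_add_distrib]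
  congr 1
  · refine Finset.sum_congr rfl fun i _ ↦ ?_
    simp only [Nat.cast_add, Nat.cast_one, ← le_sub_iff_add_le, Nat.choose_succ_succ,
      Nat.succ_eq_add_one, Nat.add_sub_add_right]
    split_ifs <;> ring
  · simp

lemma binomCdf_mono (m : ℕ) {α : ℝ} (h0 : 0 ≤ α) (h1 : α ≤ 1) : Monotone (binomCdf m α) := by
  intro x y hxy
  refine Finset.sum_le_sum fun i _ ↦ ?_
  have h1' : 0 ≤ 1 - α := sub_nonneg.mpr h1
  split_ifs with hx hy
  · exact le_rfl
  · exact absurd (hx.trans hxy) hy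
  · positivity
  · exact le_rfl

lemma measureReal_eq_one_of_zero_one {Ω : Type*} [MeasurableSpace Ω] {μ : Measure Ω} {X : Ω → ℝ}
    (hX : Measurable X) (hbin : ∀ ω, X ω = 0 ∨ X ω = 1) :
    μ.real {ω | X ω = 1} = μ[X] := by
  have hind : X = Set.indicator {ω | X ω = 1} 1 := by
    ext ω
    rcases hbin ω with h | h <;> simp [Set.indicator, h]
  conv_rhs => rw [hind]
  exact (integral_indicator_one (hX (measurableSet_singleton 1))).symm

/-- A sum of independent `{0,1}`-valued variables with means at least `α` stochastically dominates
the binomial distribution with success probability `α`. -/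
lemma measureReal_sum_le_binomCdf {Ω ι : Type*} [MeasurableSpace Ω] {μ : Measure Ω}
    [IsProbabilityMeasure μ] {L : ι → Ω → ℝ} (hmeas : ∀ i, Measurable (L i))
    (hbin : ∀ i ω, L i ω = 0 ∨ L i ω = 1) (hindep : iIndepFun L μ)
    {α : ℝ} (h0 : 0 ≤ α) (h1 : α ≤ 1) (hmean : ∀ i, α ≤ μ[L i]) (s : Finset ι) (x : ℝ) :
    μ.real {ω | ∑ i ∈ s, L i ω ≤ x} ≤ binomCdf s.card α x := by
  classical
  induction s using Finset.induction_on generalizing x with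
  | empty => by_cases hx : 0 ≤ x <;> simp [binomCdf, hx]
  | insert a s ha ih =>
    have hind : IndepFun (fun ω ↦ ∑ i ∈ s, L i ω) (L a) μ := by
      simpa only [← Finset.sum_apply] using hindep.indepFun_finsetSum_of_notMem hmeas ha
    have hprod (y c : ℝ) : μ.real ({ω | ∑ i ∈ s, L i ω ≤ y} ∩ {ω | L a ω = c}) =
        μ.real {ω | ∑ i ∈ s, L i ω ≤ y} * μ.real {ω | L a ω = c} := by
      have h := hind.measure_inter_preimage_eq_mul _ _ (measurableSet_Iic (a := y))
        (measurableSet_singleton c)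
      exact (congrArg ENNReal.toReal h).trans ENNReal.toReal_mul
    have hone := measureReal_eq_one_of_zero_one (μ := μ) (hmeas a) (hbin a)
    have hzero : μ.real {ω | L a ω = 0} = 1 - μ[L a] := by
      have hset : MeasurableSet {ω | L a ω = 1} := hmeas a (measurableSet_singleton 1)
      rw [← hone, ← probReal_compl_eq_one_sub hset]
      congr 1
      ext ω
      rcases hbin a ω with h | h <;> simp [h]
    have hle : μ[L a] ≤ 1 := hone ▸ measureReal_le_one
    have hmono := binomCdf_mono s.card h0 h1 (sub_le_self x zero_le_one)
    have hsub : {ω | ∑ i ∈ insert a s, L i ω ≤ x} ⊆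
        ({ω | ∑ i ∈ s, L i ω ≤ x} ∩ {ω | L a ω = 0}) ∪
          ({ω | ∑ i ∈ s, L i ω ≤ x - 1} ∩ {ω | L a ω = 1}) := by
      intro ω hω
      rw [Set.mem_ofPred_eq, Finset.sum_insert ha] at hω
      rcases hbin a ω with h | h
      · exact Or.inl ⟨by simpa [h] using hω, h⟩
      · exact Or.inr ⟨by rw [Set.mem_ofPred_eq]; linarith, h⟩
    rw [Finset.card_insert_of_notMem ha, binomCdf_succ]
    calc μ.real {ω | ∑ i ∈ insert a s, L i ω ≤ x}
        ≤ μ.real {ω | ∑ i ∈ s, L i ω ≤ x} * (1 - μ[L a]) +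
            μ.real {ω | ∑ i ∈ s, L i ω ≤ x - 1} * μ[L a] := by
          rw [← hzero, ← hone, ← hprod, ← hprod]
          exact (measureReal_mono hsub).trans (measureReal_union_le _ _)
      _ ≤ binomCdf s.card α x * (1 - μ[L a]) + binomCdf s.card α (x - 1) * μ[L a] :=
          add_le_add (mul_le_mul_of_nonneg_right (ih x) (sub_nonneg.mpr hle))
            (mul_le_mul_of_nonneg_right (ih (x - 1)) (h0.trans (hmean a)))
      _ ≤ (1 - α) * binomCdf s.card α x + α * binomCdf s.card α (x - 1) := by
          nlinarith [mul_nonneg (sub_nonneg.mpr (hmean a)) (sub_nonneg.mpr hmono)]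

lemma finite_range_sum_of_zero_one {Ω ι : Type*} [Fintype ι] {L : ι → Ω → ℝ}
    (hbin : ∀ i ω, L i ω = 0 ∨ L i ω = 1) : (Set.range fun ω ↦ ∑ i, L i ω).Finite := by
  classical
  refine (Set.finite_range fun s : Finset ι ↦ (s.card : ℝ)).subset ?_
  rintro _ ⟨ω, rfl⟩
  refine ⟨Finset.univ.filter fun i ↦ L i ω = 1, ?_⟩
  simp only [Finset.card_filter, Nat.cast_sum]
  refine Finset.sum_congr rfl fun i _ ↦ ?_
  rcases hbin i ω with h | h <;> simp [h]

/-- For i.i.d. losses `L 1, …, L n` taking values in `{0,1}` with mean `R = E[L 1] > α`,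
the binomial-tail p-value `p = P(Bin(n, α) ≤ n * R̂)` computed from the empirical risk
`R̂ = (1/n) ∑ L i` is super-uniform: `P(p ≤ u) ≤ u` for all `u ∈ (0,1)`. -/
theorem binomial_pvalue_superuniform
    {Ω : Type*} [MeasurableSpace Ω] (μ : Measure Ω) [IsProbabilityMeasure μ]
    (n : ℕ) (hn : 0 < n) (L : Fin n → Ω → ℝ)
    (hmeas : ∀ i, Measurable (L i))
    (hbin : ∀ i ω, L i ω = 0 ∨ L i ω = 1)
    (hindep : iIndepFun L μ)
    (hident : ∀ i, IdentDistrib (L i) (L ⟨0, hn⟩) μ μ)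
    (α : ℝ) (hα : α ∈ Set.Ioo (0 : ℝ) 1)
    (hnull : μ[L ⟨0, hn⟩] > α)
    (u : ℝ) (hu : u ∈ Set.Ioo (0 : ℝ) 1) :
    μ {ω | binomCdf n α ((n : ℝ) * ((1 / (n : ℝ)) * ∑ i, L i ω)) ≤ u}
      ≤ ENNReal.ofReal u := by
  have hcancel (y : ℝ) : (n : ℝ) * ((1 / (n : ℝ)) * y) = y := by
    have : (n : ℝ) ≠ 0 := Nat.cast_ne_zero.mpr hn.ne'
    field_simp
  simp only [hcancel]
  set A := {ω | binomCdf n α (∑ i, L i ω) ≤ u}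
  rcases A.eq_empty_or_nonempty with hA | hA
  · simp [hA]
  obtain ⟨_, ⟨ω₀, hω₀, rfl⟩, hmax⟩ := Set.exists_max_image ((fun ω ↦ ∑ i, L i ω) '' A) id
    ((finite_range_sum_of_zero_one hbin).subset (Set.image_subset_range _ _)) (hA.image _)
  have hsub : A ⊆ {ω | ∑ i, L i ω ≤ ∑ i, L i ω₀} := fun ω hω ↦ hmax _ ⟨ω, hω, rfl⟩
  have hmean (i : Fin n) : α ≤ μ[L i] := (hident i).integral_eq ▸ hnull.le
  have hdom := measureReal_sum_le_binomCdf hmeas hbin hindep hα.1.le hα.2.le hmean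
    Finset.univ (∑ i, L i ω₀)
  rw [Finset.card_fin] at hdom
  rw [← ofReal_measureReal]
  exact ENNReal.ofReal_le_ofReal ((measureReal_mono hsub).trans (hdom.trans hω₀))
end

section
/- Let L_1, ..., L_n be i.i.d. random variables taking values in [0,1] with common mean R = E[L_1], let alpha in (0,1), and define the empirical risk R_hat = (1/n) * sum_{i=1}^n L_i and gamma(alpha) = min{r in N : r >= n*alpha}. Define the PRW p-value p^PRW as follows: if R_hat < (gamma(alpha) - 1)/n, then p^PRW = (alpha * (n - ceil(n*R_hat)) / (n*alpha - ceil(n*R_hat))) * P(Bin(n, alpha) <= ceil(n*R_hat)); otherwise p^PRW = max{1, (alpha * (n - gamma(alpha) + 1) / (n*alpha - gamma(alpha) + 1)) * P(Bin(n, alpha) <= gamma(alpha) - 1)}, where Bin(n, alpha) denotes a Binomial random variable with n trials and success probability alpha. If the null hypothesis holds, i.e. R > alpha, then p^PRW is super-uniform: for all u in (0,1), P(p^PRW <= u) <= u. -/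
open MeasureTheory ProbabilityTheory Real

/-- `γ(α) = min {r ∈ ℕ : r ≥ n·α}`. -/
noncomputable def gammaAlpha (n : ℕ) (α : ℝ) : ℕ :=
  sInf {r : ℕ | (n : ℝ) * α ≤ (r : ℝ)}

/-- The PRW p-value computed from the empirical risk `R̂`. -/
noncomputable def pPRW (n : ℕ) (α : ℝ) (Rhat : ℝ) : ℝ :=
  if Rhat < ((gammaAlpha n α : ℝ) - 1) / (n : ℝ) then
    (α * ((n : ℝ) - (⌈(n : ℝ) * Rhat⌉₊ : ℝ))) / ((n : ℝ) * α - (⌈(n : ℝ) * Rhat⌉₊ : ℝ))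
      * binomCdf n α (⌈(n : ℝ) * Rhat⌉₊ : ℝ)
  else
    max 1 ((α * ((n : ℝ) - (gammaAlpha n α : ℝ) + 1))
        / ((n : ℝ) * α - (gammaAlpha n α : ℝ) + 1)
      * binomCdf n α ((gammaAlpha n α : ℝ) - 1))

/-- The probability that a Binomial variable with `n` trials and success probability `α`
equals `j`. -/
noncomputable def binomWeight (n : ℕ) (α : ℝ) (j : ℕ) : ℝ :=
  (n.choose j : ℝ) * α ^ j * (1 - α) ^ (n - j)

lemma binomWeight_nonneg {α : ℝ} (h0 : 0 ≤ α) (h1 : α ≤ 1) (n j : ℕ) :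
    0 ≤ binomWeight n α j := by
  have : 0 ≤ 1 - α := by linarith
  unfold binomWeight
  positivity

lemma binomWeight_succ_mul (n : ℕ) (α : ℝ) (k : ℕ) :
    ((k : ℝ) + 1) * (1 - α) * binomWeight n α (k + 1) = α * (n - k) * binomWeight n α k := by
  unfold binomWeight
  rcases lt_trichotomy k n with h | h | h
  · obtain ⟨m, rfl⟩ := Nat.exists_eq_add_of_lt h
    have hc := congrArg (Nat.cast (R := ℝ)) (Nat.choose_succ_right_eq (k + m + 1) k)
    have e1 : k + m + 1 - (k + 1) = m := by omega
    have e2 : k + m + 1 - k = m + 1 := by omega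
    rw [e2] at hc
    rw [e1, e2]
    push_cast at hc ⊢
    linear_combination (α ^ (k + 1) * (1 - α) ^ (m + 1)) * hc
  · subst h
    simp
  · simp [Nat.choose_eq_zero_of_lt h, Nat.choose_eq_zero_of_lt (Nat.lt_succ_of_lt h)]

lemma binomCdf_nonneg {α : ℝ} (h0 : 0 ≤ α) (h1 : α ≤ 1) (n : ℕ) (x : ℝ) :
    0 ≤ binomCdf n α x := by
  refine Finset.sum_nonneg fun i _ => ?_
  split_ifs
  · exact binomWeight_nonneg h0 h1 n i
  · exact le_rfl

lemma binomCdf_natCast_zero (n : ℕ) (α : ℝ) : binomCdf n α (0 : ℕ) = binomWeight n α 0 := by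
  simp [binomCdf, binomWeight]

lemma binomCdf_natCast_succ (n : ℕ) (α : ℝ) (k : ℕ) :
    binomCdf n α (k + 1 : ℕ) = binomCdf n α k + binomWeight n α (k + 1) := by
  have hw : binomWeight n α (k + 1)
      = ∑ i ∈ Finset.range (n + 1), if i = k + 1 then binomWeight n α i else 0 := by
    rw [Finset.sum_ite_eq']
    split_ifs with h
    · rfl
    · rw [Finset.mem_range, not_lt] at h
      simp [binomWeight, Nat.choose_eq_zero_of_lt (show n < k + 1 by omega)]
  rw [hw, binomCdf, binomCdf, ← Finset.sum_add_distrib]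
  refine Finset.sum_congr rfl fun i _ => ?_
  simp only [Nat.cast_le, binomWeight]
  rcases lt_trichotomy i (k + 1) with h | h | h
  · simp [h.le, h.ne, Nat.lt_succ_iff.mp h]
  · simp [h]
  · simp [h.ne', show ¬ i ≤ k + 1 by omega, show ¬ i ≤ k by omega]

lemma binomCdf_succ_ratio {α : ℝ} (h0 : 0 ≤ α) (h1 : α ≤ 1) (n k : ℕ) :
    α * (n - k) * binomCdf n α k ≤ (k + 1) * (1 - α) * binomCdf n α (k + 1 : ℕ) := by
  induction k with
  | zero =>
    have h := binomWeight_succ_mul n α 0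
    rw [binomCdf_natCast_succ, binomCdf_natCast_zero]
    have := mul_nonneg (sub_nonneg.mpr h1) (binomWeight_nonneg h0 h1 n 0)
    push_cast at h ⊢
    linarith
  | succ k ih =>
    have h := binomWeight_succ_mul n α (k + 1)
    rw [binomCdf_natCast_succ n α (k + 1)]
    have hF := mul_nonneg (sub_nonneg.mpr h1) (binomCdf_nonneg h0 h1 n (k + 1 : ℕ))
    have hF' := mul_nonneg h0 (binomCdf_nonneg h0 h1 n k)
    have hs := binomCdf_natCast_succ n α k
    have hs' := congrArg (fun x => α * ((n : ℝ) - (k + 1)) * x) hs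
    push_cast at h ih hF hs hs' ⊢
    linarith

/-- The lower hinge moment `E[(c - B)₊]` of a Binomial variable `B`. -/
noncomputable def binomHinge (n : ℕ) (α : ℝ) (c : ℝ) : ℝ :=
  ∑ j ∈ Finset.range (n + 1), binomWeight n α j * max (c - j) 0

lemma binomHinge_nonneg {α : ℝ} (h0 : 0 ≤ α) (h1 : α ≤ 1) (n : ℕ) (c : ℝ) :
    0 ≤ binomHinge n α c :=
  Finset.sum_nonneg fun j _ => mul_nonneg (binomWeight_nonneg h0 h1 n j) (le_max_right _ _)

lemma binomHinge_zero (n : ℕ) (α : ℝ) : binomHinge n α (0 : ℕ) = 0 := by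
  simp [binomHinge]

lemma binomHinge_succ (n : ℕ) (α : ℝ) (k : ℕ) :
    binomHinge n α (k + 1 : ℕ) = binomHinge n α k + binomCdf n α k := by
  rw [binomHinge, binomHinge, binomCdf, ← Finset.sum_add_distrib]
  refine Finset.sum_congr rfl fun j _ => ?_
  simp only [Nat.cast_le, binomWeight, Nat.cast_add, Nat.cast_one]
  rcases le_or_gt j k with h | h
  · have h' : (j : ℝ) ≤ k := by exact_mod_cast h
    rw [if_pos h, max_eq_left (by linarith), max_eq_left (by linarith)]
    ring
  · have h' : (k : ℝ) + 1 ≤ j := by exact_mod_cast h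
    rw [if_neg (by omega), max_eq_right (by linarith), max_eq_right (by linarith)]
    ring

lemma binomHinge_succ_le {α : ℝ} (h0 : 0 ≤ α) (h1 : α ≤ 1) (n k : ℕ) :
    (n * α - k) * binomHinge n α (k + 1 : ℕ) ≤ α * (n - k) * binomCdf n α k := by
  induction k with
  | zero =>
    rw [binomHinge_succ, binomHinge_zero]
    apply le_of_eq
    push_cast
    ring
  | succ k ih =>
    have hr := binomCdf_succ_ratio h0 h1 n k
    have hS := binomHinge_nonneg h0 h1 n (k + 1 : ℕ)
    rw [binomHinge_succ n α (k + 1)]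
    push_cast at *
    linarith

lemma sum_binomWeight_succ (n : ℕ) (α : ℝ) (g : ℕ → ℝ) :
    ∑ j ∈ Finset.range (n + 2), binomWeight (n + 1) α j * g j
      = ∑ j ∈ Finset.range (n + 1), binomWeight n α j * ((1 - α) * g j + α * g (j + 1)) := by
  have h := Finset.sum_choose_succ_mul (fun i m => α ^ i * (1 - α) ^ m * g i) n
  simp only [binomWeight]
  simp only [← mul_assoc] at h
  rw [h, ← Finset.sum_add_distrib]
  refine Finset.sum_congr rfl fun j hj => ?_
  have : n + 1 - j = (n - j) + 1 := by
    rw [Finset.mem_range] at hj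
    omega
  rw [this]
  ring

/-- Among sums of independent `[0,1]`-valued variables with means at least `α`, the binomial
distribution maximizes the expectation of every convex nonincreasing function. -/
lemma integral_comp_sum_le_binomial
    {Ω ι : Type*} [MeasurableSpace Ω] {μ : Measure Ω} [IsProbabilityMeasure μ]
    {L : ι → Ω → ℝ} (hmeas : ∀ i, Measurable (L i))
    (hval : ∀ i ω, L i ω ∈ Set.Icc (0 : ℝ) 1) (hindep : iIndepFun L μ)
    {α : ℝ} (h0 : 0 ≤ α) (h1 : α ≤ 1) (hmean : ∀ i, α ≤ ∫ ω, L i ω ∂μ)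
    (s : Finset ι) {g : ℝ → ℝ} (hconv : ConvexOn ℝ Set.univ g) (hanti : Antitone g) :
    ∫ ω, g (∑ i ∈ s, L i ω) ∂μ
      ≤ ∑ j ∈ Finset.range (s.card + 1), binomWeight s.card α j * g j := by
  classical
  induction s using Finset.induction_on generalizing g with
  | empty => simp [binomWeight]
  | insert a s ha ih =>
    set S : Ω → ℝ := fun ω => ∑ i ∈ s, L i ω with hS
    have hSm : Measurable S := Finset.measurable_sum s fun i _ => hmeas i
    have hS0 : ∀ ω, 0 ≤ S ω := fun ω => Finset.sum_nonneg fun i _ => (hval i ω).1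
    have hS1 : ∀ ω, S ω ≤ s.card := fun ω =>
      (Finset.sum_le_card_nsmul s _ 1 fun i _ => (hval i ω).2).trans_eq (by simp)
    have hint : ∀ {f : Ω → ℝ} {c : ℝ}, Measurable f → (∀ ω, f ω ∈ Set.Icc 0 c) →
        Integrable (fun ω => g (f ω)) μ := fun {f c} hf hb =>
      Integrable.of_mem_Icc (g c) (g 0) (hanti.measurable.comp hf).aemeasurable
        (ae_of_all _ fun ω => ⟨hanti (hb ω).2, hanti (hb ω).1⟩)
    have hgS : Integrable (fun ω => g (S ω)) μ := hint hSm fun ω => ⟨hS0 ω, hS1 ω⟩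
    have hgS' : Integrable (fun ω => g (S ω + 1)) μ :=
      hint (c := s.card + 1) (hSm.add_const 1) fun ω => ⟨by linarith [hS0 ω], by linarith [hS1 ω]⟩
    have hgL : Integrable (fun ω => g (L a ω + S ω)) μ :=
      hint (c := 1 + s.card) ((hmeas a).add hSm) fun ω =>
        ⟨by linarith [hS0 ω, (hval a ω).1], by linarith [hS1 ω, (hval a ω).2]⟩
    have hLa : Integrable (L a) μ :=
      Integrable.of_mem_Icc 0 1 (hmeas a).aemeasurable (ae_of_all _ (hval a))
    set D : ℝ → ℝ := fun x => g x - g (x + 1) with hD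
    have hDm : Measurable D := hanti.measurable.sub (hanti.measurable.comp (measurable_add_const 1))
    have hD0 : ∀ x, 0 ≤ D x := fun x => sub_nonneg.mpr (hanti (by linarith))
    have hDS : Integrable (fun ω => D (S ω)) μ := hgS.sub hgS'
    have hind : IndepFun (L a) (fun ω => D (S ω)) μ := by
      have h := (hindep.indepFun_finsetSum_of_notMem hmeas ha).symm
      have hS' : (∑ i ∈ s, L i) = S := by
        ext ω
        simp [hS]
      rw [hS'] at h
      exact h.comp measurable_id hDm
    have hLD : Integrable (fun ω => L a ω * D (S ω)) μ := hind.integrable_mul hLa hDS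
    have hprod : ∫ ω, L a ω * D (S ω) ∂μ = (∫ ω, L a ω ∂μ) * ∫ ω, D (S ω) ∂μ :=
      hind.integral_fun_mul_eq_mul_integral hLa.aestronglyMeasurable hDS.aestronglyMeasurable
    have hDint : 0 ≤ ∫ ω, D (S ω) ∂μ := integral_nonneg fun ω => hD0 _
    have hpt : ∀ ω, g (L a ω + S ω) ≤ g (S ω) - L a ω * D (S ω) := fun ω => by
      have h := hconv.2 (Set.mem_univ (S ω)) (Set.mem_univ (S ω + 1))
        (sub_nonneg.mpr (hval a ω).2) (hval a ω).1 (by ring)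
      simp only [smul_eq_mul] at h
      rw [show (1 - L a ω) * S ω + L a ω * (S ω + 1) = L a ω + S ω by ring] at h
      simp only [hD]
      linarith
    have hTconv : ConvexOn ℝ Set.univ fun x => (1 - α) * g x + α * g (x + 1) := by
      have h2 : ConvexOn ℝ Set.univ fun x => g (x + 1) := by
        simpa [Function.comp_def] using hconv.translate_left 1
      exact (hconv.smul (sub_nonneg.mpr h1)).add (h2.smul h0)
    have hTanti : Antitone fun x => (1 - α) * g x + α * g (x + 1) := fun x y hxy =>
      add_le_add (mul_le_mul_of_nonneg_left (hanti hxy) (sub_nonneg.mpr h1))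
        (mul_le_mul_of_nonneg_left (hanti (by linarith)) h0)
    simp only [Finset.sum_insert ha, Finset.card_insert_of_notMem ha]
    calc ∫ ω, g (L a ω + S ω) ∂μ
        ≤ ∫ ω, (g (S ω) - L a ω * D (S ω)) ∂μ := integral_mono hgL (hgS.sub hLD) hpt
      _ = ∫ ω, g (S ω) ∂μ - (∫ ω, L a ω ∂μ) * ∫ ω, D (S ω) ∂μ := by
        rw [integral_sub hgS hLD, hprod]
      _ ≤ ∫ ω, g (S ω) ∂μ - α * ∫ ω, D (S ω) ∂μ :=
        sub_le_sub_left (mul_le_mul_of_nonneg_right (hmean a) hDint) _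
      _ = ∫ ω, ((1 - α) * g (S ω) + α * g (S ω + 1)) ∂μ := by
        rw [← integral_const_mul, ← integral_sub hgS (hDS.const_mul α)]
        congr 1 with ω
        simp only [hD]
        ring
      _ ≤ _ := ih hTconv hTanti
      _ = _ := by
        have h := sum_binomWeight_succ s.card α fun j => g j
        push_cast at h
        exact h.symm

/-- Lower-tail bound for sums of independent `[0,1]`-valued variables by the binomial hinge
moment. -/
lemma measureReal_sum_le_binomHinge
    {Ω : Type*} [MeasurableSpace Ω] {μ : Measure Ω} [IsProbabilityMeasure μ]
    {n : ℕ} {L : Fin n → Ω → ℝ} (hmeas : ∀ i, Measurable (L i))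
    (hval : ∀ i ω, L i ω ∈ Set.Icc (0 : ℝ) 1) (hindep : iIndepFun L μ)
    {α : ℝ} (h0 : 0 ≤ α) (h1 : α ≤ 1) (hmean : ∀ i, α ≤ ∫ ω, L i ω ∂μ) (k : ℕ) :
    μ.real {ω | ∑ i, L i ω ≤ k} ≤ binomHinge n α (k + 1 : ℕ) := by
  set g : ℝ → ℝ := fun x => max (((k + 1 : ℕ) : ℝ) - x) 0 with hg
  have hconv : ConvexOn ℝ Set.univ g :=
    ((convexOn_const _ convex_univ).sub (concaveOn_id convex_univ)).sup
      (convexOn_const _ convex_univ)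
  have hanti : Antitone g := fun x y hxy => max_le_max (by linarith) le_rfl
  have hSm : Measurable fun ω => ∑ i, L i ω := Finset.measurable_sum _ fun i _ => hmeas i
  have hE : MeasurableSet {ω | ∑ i, L i ω ≤ k} := measurableSet_le hSm measurable_const
  have hint : Integrable (fun ω => g (∑ i, L i ω)) μ :=
    Integrable.of_mem_Icc 0 (g 0) (hanti.measurable.comp hSm).aemeasurable
      (ae_of_all _ fun ω => ⟨le_max_right _ _,
        hanti (Finset.sum_nonneg fun i _ => (hval i ω).1)⟩)
  have hB := integral_comp_sum_le_binomial hmeas hval hindep h0 h1 hmean Finset.univ hconv hanti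
  rw [Finset.card_univ, Fintype.card_fin] at hB
  refine le_trans ?_ hB
  rw [← integral_indicator_one hE]
  refine integral_mono ((integrable_const 1).indicator hE) hint fun ω => ?_
  by_cases hω : ∑ i, L i ω ≤ k
  · have h : (1 : ℝ) ≤ g (∑ i, L i ω) := le_max_of_le_left (by push_cast; linarith)
    simpa [Set.indicator, hω] using h
  · simp [Set.indicator, hω, hg]

lemma natCast_lt_of_lt_gammaAlpha {n : ℕ} {α : ℝ} {k : ℕ} (h : k < gammaAlpha n α) :
    (k : ℝ) < n * α :=
  not_le.mp (Nat.notMem_of_lt_sInf h)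

/-- For i.i.d. losses `L 1, …, L n` taking values in `[0,1]` with mean `R = E[L 1] > α`,
the PRW p-value computed from the empirical risk `R̂ = (1/n) ∑ L i` is super-uniform:
`P(p^PRW ≤ u) ≤ u` for all `u ∈ (0,1)`. -/
theorem pPRW_superuniform
    {Ω : Type*} [MeasurableSpace Ω] (μ : Measure Ω) [IsProbabilityMeasure μ]
    (n : ℕ) (hn : 0 < n) (L : Fin n → Ω → ℝ)
    (hmeas : ∀ i, Measurable (L i))
    (hval : ∀ i ω, L i ω ∈ Set.Icc (0 : ℝ) 1)
    (hindep : iIndepFun L μ)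
    (hident : ∀ i, IdentDistrib (L i) (L ⟨0, hn⟩) μ μ)
    (α : ℝ) (hα : α ∈ Set.Ioo (0 : ℝ) 1)
    (hnull : μ[L ⟨0, hn⟩] > α)
    (u : ℝ) (hu : u ∈ Set.Ioo (0 : ℝ) 1) :
    μ {ω | pPRW n α ((1 / (n : ℝ)) * ∑ i, L i ω) ≤ u} ≤ ENNReal.ofReal u := by
  have h0 : 0 ≤ α := hα.1.le
  have h1 : α ≤ 1 := hα.2.le
  have hn' : (0 : ℝ) < n := by exact_mod_cast hn
  have hmean : ∀ i, α ≤ ∫ ω, L i ω ∂μ := fun i => by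
    rw [(hident i).integral_eq]
    exact hnull.le
  set K : Set ℕ := {k | (k : ℝ) < n * α ∧
    α * ((n : ℝ) - k) / (n * α - k) * binomCdf n α k ≤ u}
  have hsub : ∀ ω, pPRW n α ((1 / (n : ℝ)) * ∑ i, L i ω) ≤ u →
      ∃ k ∈ K, ∑ i, L i ω ≤ k := by
    intro ω hω
    have hcancel : (n : ℝ) * ((1 / (n : ℝ)) * ∑ i, L i ω) = ∑ i, L i ω := by
      field_simp
    unfold pPRW at hω
    split_ifs at hω with hlt
    · rw [hcancel] at hω
      refine ⟨⌈∑ i, L i ω⌉₊, ⟨natCast_lt_of_lt_gammaAlpha ?_, hω⟩, Nat.le_ceil _⟩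
      rw [lt_div_iff₀ hn', mul_comm, hcancel] at hlt
      have hpos : 0 ≤ ∑ i, L i ω := Finset.sum_nonneg fun i _ => (hval i ω).1
      have hγ : 1 ≤ gammaAlpha n α := by
        have : (0 : ℝ) < gammaAlpha n α := by linarith
        exact_mod_cast this
      have : ⌈∑ i, L i ω⌉₊ ≤ gammaAlpha n α - 1 := by
        rw [Nat.ceil_le, Nat.cast_sub hγ]
        exact_mod_cast hlt.le
      omega
    · linarith [le_max_left (1 : ℝ) ((α * ((n : ℝ) - (gammaAlpha n α : ℝ) + 1))
        / ((n : ℝ) * α - (gammaAlpha n α : ℝ) + 1)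
      * binomCdf n α ((gammaAlpha n α : ℝ) - 1)), hu.2]
  have hKbdd : BddAbove K := ⟨⌈(n : ℝ) * α⌉₊, fun k hk => by
    exact_mod_cast hk.1.le.trans (Nat.le_ceil _)⟩
  rcases K.eq_empty_or_nonempty with hemp | hne
  · have : {ω | pPRW n α ((1 / (n : ℝ)) * ∑ i, L i ω) ≤ u} = ∅ := by
      refine Set.eq_empty_of_forall_notMem fun ω hω => ?_
      obtain ⟨k, hk, -⟩ := hsub ω hω
      simp [hemp] at hk
    rw [this, measure_empty]
    exact zero_le
  · obtain ⟨hmlt, hmu⟩ : sSup K ∈ K := Nat.sSup_mem hne hKbdd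
    set m := sSup K
    have hle : {ω | pPRW n α ((1 / (n : ℝ)) * ∑ i, L i ω) ≤ u} ⊆ {ω | ∑ i, L i ω ≤ m} := by
      intro ω hω
      obtain ⟨k, hk, hkω⟩ := hsub ω hω
      exact hkω.trans (by exact_mod_cast le_csSup hKbdd hk)
    refine (measure_mono hle).trans ?_
    rw [← ofReal_measureReal]
    refine ENNReal.ofReal_le_ofReal (le_trans ?_ hmu)
    refine (measureReal_sum_le_binomHinge hmeas hval hindep h0 h1 hmean m).trans ?_
    rw [div_mul_eq_mul_div, le_div_iff₀ (sub_pos.mpr hmlt), mul_comm]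
    exact binomHinge_succ_le h0 h1 n m
end

section
/- Let L_1, ..., L_n be i.i.d. random variables taking values in [0,1] with mean mu = E[L_1], let alpha in (0,1) with mu > alpha, and let S = sum_{i=1}^n L_i. Then for every integer k with 0 <= k <= n, P( S <= k ) <= e * P( Bin(n, alpha) <= k ), where e is Euler's number and Bin(n, alpha) denotes a Binomial random variable with n trials and success probability alpha. -/
open MeasureTheory ProbabilityTheory Real

namespace Bentkus

/-- The binomial mass function, extended by zero beyond `n`. -/
noncomputable def binomPmf (n : ℕ) (α : ℝ) (i : ℕ) : ℝ :=
  (n.choose i : ℝ) * (α ^ i * (1 - α) ^ (n - i))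

lemma binomPmf_nonneg {n : ℕ} {α : ℝ} (h0 : 0 ≤ α) (h1 : α ≤ 1) (i : ℕ) :
    0 ≤ binomPmf n α i := by
  have : 0 ≤ 1 - α := by linarith
  unfold binomPmf
  positivity

lemma binomPmf_pos {n : ℕ} {α : ℝ} (h0 : 0 < α) (h1 : α < 1) {i : ℕ} (hi : i ≤ n) :
    0 < binomPmf n α i := by
  have : 0 < 1 - α := by linarith
  have : 0 < n.choose i := Nat.choose_pos hi
  unfold binomPmf
  positivity

lemma binomPmf_succ (n : ℕ) (α : ℝ) {i : ℕ} (hi : i ≤ n) :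
    (i + 1) * (1 - α) * binomPmf n α (i + 1) = (n - i) * α * binomPmf n α i := by
  rcases hi.eq_or_lt with rfl | hlt
  · simp [binomPmf]
  · have hc : ((n.choose (i + 1) : ℝ)) * (i + 1) = n.choose i * (n - i) := by
      have := Nat.choose_succ_right_eq n i
      rw [← Nat.cast_sub hi]
      exact_mod_cast this
    obtain ⟨d, rfl⟩ := Nat.exists_eq_add_of_lt hlt
    have e1 : i + d + 1 - (i + 1) = d := by omega
    have e2 : i + d + 1 - i = d + 1 := by omega
    simp only [binomPmf, e1, e2]
    linear_combination (α ^ (i + 1) * (1 - α) ^ (d + 1)) * hc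

lemma binomPmf_logConcave {n : ℕ} {α : ℝ} (h0 : 0 < α) (h1 : α < 1) {i j : ℕ} (hij : i ≤ j) :
    binomPmf n α i * binomPmf n α (j + 2) ≤ binomPmf n α (i + 1) * binomPmf n α (j + 1) := by
  have hp := fun l => binomPmf_nonneg (n := n) h0.le h1.le l
  rcases Nat.lt_or_ge n (j + 1) with hj | hj
  · have : binomPmf n α (j + 2) = 0 := by
      simp [binomPmf, Nat.choose_eq_zero_of_lt (show n < j + 2 by omega)]
    rw [this, mul_zero]
    exact mul_nonneg (hp _) (hp _)
  · have ei := binomPmf_succ n α (show i ≤ n by omega)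
    have ej := binomPmf_succ n α hj
    push_cast at ej
    have hβ : 0 < 1 - α := by linarith
    have hij' : (i : ℝ) ≤ j := by exact_mod_cast hij
    have hjn : (j : ℝ) + 1 ≤ n := by exact_mod_cast hj
    have hcoef : ((n : ℝ) - (j + 1)) * (i + 1) ≤ (n - i) * (j + 1 + 1) := by
      have : (0 : ℝ) ≤ i := by positivity
      nlinarith
    have hpos : 0 < ((i : ℝ) + 1) * (j + 1 + 1) * (1 - α) := by positivity
    refine le_of_mul_le_mul_left ?_ hpos
    calc _ = binomPmf n α i * (i + 1) * ((j + 1 + 1) * (1 - α) * binomPmf n α (j + 2)) := by ring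
      _ = (((n : ℝ) - (j + 1)) * (i + 1)) * (α * binomPmf n α i * binomPmf n α (j + 1)) := by
          rw [show j + 2 = j + 1 + 1 from rfl, ej]; ring
      _ ≤ ((n - i) * (j + 1 + 1)) * (α * binomPmf n α i * binomPmf n α (j + 1)) :=
          mul_le_mul_of_nonneg_right hcoef
            (mul_nonneg (mul_nonneg h0.le (hp _)) (hp _))
      _ = ((i + 1) * (1 - α) * binomPmf n α (i + 1)) * ((j + 1 + 1) * binomPmf n α (j + 1)) := by
          rw [ei]; ring
      _ = _ := by ring

/-- Partial sums of a log-concave sequence are log-concave. -/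
lemma sum_range_logConcave {p : ℕ → ℝ} (hp : ∀ i, 0 ≤ p i)
    (hlc : ∀ i j, i ≤ j → p i * p (j + 2) ≤ p (i + 1) * p (j + 1)) (j : ℕ) :
    (∑ i ∈ Finset.range (j + 1), p i) * ∑ i ∈ Finset.range (j + 3), p i
      ≤ (∑ i ∈ Finset.range (j + 2), p i) ^ 2 := by
  have h : (∑ i ∈ Finset.range (j + 1), p i) * p (j + 2)
      ≤ (∑ i ∈ Finset.range (j + 2), p i) * p (j + 1) := by
    rw [Finset.sum_range_succ' p (j + 1), add_mul, Finset.sum_mul, Finset.sum_mul]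
    have : 0 ≤ p 0 * p (j + 1) := mul_nonneg (hp _) (hp _)
    have := Finset.sum_le_sum (s := Finset.range (j + 1))
      (f := fun i => p i * p (j + 2)) (g := fun i => p (i + 1) * p (j + 1))
      fun i hi => hlc i j (by simpa [Nat.lt_succ_iff] using hi)
    linarith
  rw [Finset.sum_range_succ p (j + 2)]
  have e := Finset.sum_range_succ p (j + 1)
  rw [show j + 1 + 1 = j + 2 from rfl] at e
  set A := ∑ i ∈ Finset.range (j + 1), p i
  set B := ∑ i ∈ Finset.range (j + 2), p i
  rw [show A = B - p (j + 1) by linarith] at h ⊢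
  linarith

/-- A positive log-concave sequence lies below the geometric sequence tangent to it at `k`. -/
lemma mul_pow_le_mul_pow_of_logConcave {F : ℕ → ℝ} (hF : ∀ j, 0 < F j)
    (hlc : ∀ j, F j * F (j + 2) ≤ F (j + 1) ^ 2) (k j : ℕ) :
    F j * (F (k + 1) / F k) ^ k ≤ F k * (F (k + 1) / F k) ^ j := by
  have hanti : Antitone fun j => F (j + 1) / F j := by
    refine antitone_nat_of_succ_le fun j => ?_
    rw [div_le_div_iff₀ (hF _) (hF _)]
    linarith [hlc j]
  set q := F (k + 1) / F k
  have hq0 : 0 < q := div_pos (hF _) (hF _)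
  rcases le_total k j with h | h
  · induction j, h using Nat.le_induction with
    | base => rfl
    | succ j hkj ih =>
      have hr : F (j + 1) ≤ q * F j := (div_le_iff₀ (hF j)).1 (hanti hkj)
      calc F (j + 1) * q ^ k ≤ q * F j * q ^ k := by gcongr
        _ = q * (F j * q ^ k) := by ring
        _ ≤ q * (F k * q ^ j) := by gcongr
        _ = _ := by ring
  · induction h using Nat.decreasingInduction with
    | self => rfl
    | of_succ j hjk ih =>
      have hr : q * F j ≤ F (j + 1) := (le_div_iff₀ (hF j)).1 (hanti (Nat.le_of_lt hjk))
      refine le_of_mul_le_mul_left ?_ hq0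
      calc q * (F j * q ^ k) = q * F j * q ^ k := by ring
        _ ≤ F (j + 1) * q ^ k := by gcongr
        _ ≤ F k * q ^ (j + 1) := ih
        _ = _ := by ring

/-- Summation by parts for the truncated first moment. -/
lemma sum_range_mul_sub (p : ℕ → ℝ) (t : ℝ) (m : ℕ) :
    ∑ i ∈ Finset.range (m + 1), p i * (t - i)
      = ∑ j ∈ Finset.range m, (∑ i ∈ Finset.range (j + 1), p i)
        + (t - m) * ∑ i ∈ Finset.range (m + 1), p i := by
  induction m with
  | zero => simp [mul_comm]
  | succ m ih =>
    rw [Finset.sum_range_succ, ih, Finset.sum_range_succ (fun j => ∑ i ∈ Finset.range (j + 1), p i) m, Finset.sum_range_succ p (m + 1)]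
    push_cast
    ring

lemma sum_exp_pow_add_le {s t : ℝ} (hs : 0 < s) (m : ℕ) :
    ∑ j ∈ Finset.range m, exp s ^ j + (t - m) * exp s ^ m ≤ exp (s * t) / s := by
  have hs1 : s ≤ exp s - 1 := by linarith [add_one_le_exp s]
  have hpow : exp s ^ m = exp (s * m) := by rw [← exp_nat_mul, mul_comm]
  have hgeom : ∑ j ∈ Finset.range m, exp s ^ j ≤ exp s ^ m / s := by
    rw [geom_sum_eq (by linarith)]
    calc (exp s ^ m - 1) / (exp s - 1) ≤ exp s ^ m / (exp s - 1) := by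
          have : 0 < exp s - 1 := by linarith
          gcongr; linarith
      _ ≤ _ := by gcongr
  calc _ ≤ exp s ^ m / s + (t - m) * exp s ^ m := by gcongr
    _ = exp (s * m) * (s * (t - m) + 1) / s := by rw [hpow]; field_simp; ring
    _ ≤ exp (s * m) * exp (s * (t - m)) / s := by gcongr; exact add_one_le_exp _
    _ = _ := by rw [← exp_add]; ring_nf

/-- For a log-concave mass function, the Markov bound based on `x ↦ (t - x)₊` recovers the
distribution function up to the factor `e` for a suitable `t > k`. -/
lemma exists_sum_mul_max_le {p : ℕ → ℝ} (hp : ∀ i, 0 ≤ p i) (hp0 : 0 < p 0)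
    (hlc : ∀ i j, i ≤ j → p i * p (j + 2) ≤ p (i + 1) * p (j + 1)) {k : ℕ}
    (hk : 0 < p (k + 1)) (n : ℕ) :
    ∃ t : ℝ, k < t ∧ ∑ i ∈ Finset.range n, p i * max (t - i) 0
      ≤ (t - k) * (exp 1 * ∑ i ∈ Finset.range (k + 1), p i) := by
  set F : ℕ → ℝ := fun j => ∑ i ∈ Finset.range (j + 1), p i with hFdef
  have hF : ∀ j, 0 < F j := fun j =>
    Finset.sum_pos' (fun i _ => hp i) ⟨0, by simp, hp0⟩
  have hbound := mul_pow_le_mul_pow_of_logConcave hF (sum_range_logConcave hp hlc) k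
  have hq1 : 1 < F (k + 1) / F k := by
    rw [one_lt_div (hF k)]
    simp only [hFdef]
    rw [Finset.sum_range_succ p (k + 1)]
    linarith
  set q := F (k + 1) / F k
  set s := log q
  have hs : 0 < s := log_pos hq1
  have hqs : q = exp s := (exp_log (by linarith)).symm
  have hst : s * (k + 1 / s) = k * s + 1 := by field_simp
  refine ⟨k + 1 / s, by linarith [one_div_pos.2 hs], ?_⟩
  set t : ℝ := k + 1 / s with ht
  have ht0 : 0 ≤ t := by positivity
  set m := ⌊t⌋₊
  have hmt : (m : ℝ) ≤ t := Nat.floor_le ht0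
  have htrunc : ∑ i ∈ Finset.range n, p i * max (t - i) 0
      ≤ ∑ i ∈ Finset.range (m + 1), p i * (t - i) := by
    calc _ ≤ ∑ i ∈ Finset.range (n + (m + 1)), p i * max (t - i) 0 :=
          Finset.sum_le_sum_of_subset_of_nonneg (Finset.range_mono (by omega))
            fun i _ _ => mul_nonneg (hp i) (le_max_right _ _)
      _ = ∑ i ∈ Finset.range (m + 1), p i * max (t - i) 0 := by
          symm
          refine Finset.sum_subset (Finset.range_mono (by omega)) fun i _ hi => ?_
          have hmi : m < i := by simpa using hi
          have : t < i := (Nat.floor_lt ht0).1 hmi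
          rw [max_eq_right (by linarith), mul_zero]
      _ = _ := by
          refine Finset.sum_congr rfl fun i hi => ?_
          have : i ≤ m := by simpa [Nat.lt_succ_iff] using hi
          have : (i : ℝ) ≤ m := by exact_mod_cast this
          rw [max_eq_left (by linarith)]
  refine htrunc.trans ?_
  rw [sum_range_mul_sub]
  change ∑ j ∈ Finset.range m, F j + (t - m) * F m ≤ (t - k) * (exp 1 * F k)
  have hqk : 0 < q ^ k := by positivity
  refine le_of_mul_le_mul_right ?_ hqk
  calc (∑ j ∈ Finset.range m, F j + (t - m) * F m) * q ^ k
      = ∑ j ∈ Finset.range m, F j * q ^ k + (t - m) * (F m * q ^ k) := by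
        rw [add_mul, Finset.sum_mul, mul_assoc]
    _ ≤ ∑ j ∈ Finset.range m, F k * q ^ j + (t - m) * (F k * q ^ m) := by
        have : 0 ≤ t - m := by linarith
        exact add_le_add (Finset.sum_le_sum fun j _ => hbound j)
          (mul_le_mul_of_nonneg_left (hbound m) this)
    _ = F k * (∑ j ∈ Finset.range m, exp s ^ j + (t - m) * exp s ^ m) := by
        rw [← Finset.mul_sum, hqs]; ring
    _ ≤ F k * (exp (s * t) / s) :=
        mul_le_mul_of_nonneg_left (sum_exp_pow_add_le hs m) (hF k).le
    _ = (t - k) * (exp 1 * F k) * q ^ k := by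
        rw [hst, exp_add, exp_nat_mul, hqs, show t - k = 1 / s by rw [ht]; ring]
        ring

lemma sum_binomPmf_succ_mul (n : ℕ) (α : ℝ) (f : ℝ → ℝ) :
    ∑ i ∈ Finset.range (n + 2), binomPmf (n + 1) α i * f i
      = ∑ i ∈ Finset.range (n + 1), binomPmf n α i * ((1 - α) * f i + α * f (i + 1)) := by
  have h := Finset.sum_choose_succ_mul (fun i j => α ^ i * (1 - α) ^ j * f i) n
  simp only [binomPmf, mul_assoc] at h ⊢
  rw [h, ← Finset.sum_add_distrib]
  refine Finset.sum_congr rfl fun i hi => ?_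
  have hi' : i ≤ n := by simpa [Nat.lt_succ_iff] using hi
  rw [Nat.succ_sub hi', Nat.succ_eq_add_one]
  push_cast
  ring

/-- A sum of independent `[0,1]`-valued variables with means at least `α` is dominated by the
binomial distribution in the decreasing convex order. -/
lemma integral_sum_le_sum_binomPmf {Ω ι : Type*} [MeasurableSpace Ω] {μ : Measure Ω}
    [IsProbabilityMeasure μ] {L : ι → Ω → ℝ} (hmeas : ∀ i, Measurable (L i))
    (hval : ∀ i ω, L i ω ∈ Set.Icc (0 : ℝ) 1) (hindep : iIndepFun L μ) {α : ℝ}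
    (hα : α ∈ Set.Icc (0 : ℝ) 1) (hmean : ∀ i, α ≤ μ[L i]) (s : Finset ι) {f : ℝ → ℝ}
    (hconv : ConvexOn ℝ Set.univ f) (hanti : Antitone f) :
    ∫ ω, f (∑ i ∈ s, L i ω) ∂μ ≤ ∑ i ∈ Finset.range (s.card + 1), binomPmf s.card α i * f i := by
  classical
  induction s using Finset.induction_on generalizing f with
  | empty => simp [binomPmf]
  | insert a s ha ih =>
    set S : Ω → ℝ := fun ω => ∑ i ∈ s, L i ω with hS
    have hSm : Measurable S := Finset.measurable_fun_sum s fun i _ => hmeas i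
    have hS0 : ∀ ω, 0 ≤ S ω := fun ω => Finset.sum_nonneg fun i _ => (hval i ω).1
    have hS1 : ∀ ω, S ω ≤ s.card := fun ω => by
      simpa using Finset.sum_le_card_nsmul s (fun i => L i ω) 1 fun i _ => (hval i ω).2
    have hint : ∀ (g : ℝ → ℝ) (X : Ω → ℝ) (c : ℝ), Antitone g → Measurable X →
        (∀ ω, X ω ∈ Set.Icc 0 c) → Integrable (fun ω => g (X ω)) μ := by
      intro g X c hg hX hXc
      refine Integrable.of_mem_Icc (g c) (g 0) (hg.measurable.comp hX).aemeasurable ?_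
      exact ae_of_all _ fun ω => ⟨hg (hXc ω).2, hg (hXc ω).1⟩
    have hshift : Antitone fun x => f (x + 1) := fun x y h => hanti (by linarith)
    have hshiftc : ConvexOn ℝ Set.univ fun x => f (x + 1) := by
      simpa [Function.comp_def] using hconv.translate_left 1
    have hf0 : Integrable (fun ω => f (S ω)) μ :=
      hint f S s.card hanti hSm fun ω => ⟨hS0 ω, hS1 ω⟩
    have hf1 : Integrable (fun ω => f (S ω + 1)) μ :=
      hint (fun x => f (x + 1)) S s.card hshift hSm fun ω => ⟨hS0 ω, hS1 ω⟩
    have hfL : Integrable (fun ω => f (L a ω + S ω)) μ :=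
      hint f (fun ω => L a ω + S ω) (1 + s.card) hanti ((hmeas a).add hSm) fun ω =>
        ⟨add_nonneg (hval a ω).1 (hS0 ω), add_le_add (hval a ω).2 (hS1 ω)⟩
    have hLint : Integrable (L a) μ :=
      Integrable.of_mem_Icc 0 1 (hmeas a).aemeasurable (ae_of_all _ (hval a))
    set D : Ω → ℝ := fun ω => f (S ω + 1) - f (S ω) with hD
    have hDint : Integrable D μ := hf1.sub hf0
    have hDm : Measurable fun x => f (x + 1) - f x := hshift.measurable.sub hanti.measurable
    have hInd : IndepFun (L a) D μ := by
      have h := (hindep.indepFun_finsetSum_of_notMem hmeas ha).symm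
      have h' : IndepFun (L a) S μ := by
        convert h using 1
        ext ω
        simp [hS]
      exact h'.comp measurable_id hDm
    have hprod : ∫ ω, L a ω * D ω ∂μ = (∫ ω, L a ω ∂μ) * ∫ ω, D ω ∂μ :=
      hInd.integral_fun_mul_eq_mul_integral hLint.aestronglyMeasurable hDint.aestronglyMeasurable
    have hLD : Integrable (fun ω => L a ω * D ω) μ := hInd.integrable_mul hLint hDint
    have hDneg : ∫ ω, D ω ∂μ ≤ 0 :=
      integral_nonpos fun ω => sub_nonpos.2 (hanti (by linarith))
    have hpoint : ∀ ω, f (L a ω + S ω) ≤ f (S ω) + L a ω * D ω := fun ω => by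
      have h := hconv.2 (Set.mem_univ (S ω)) (Set.mem_univ (S ω + 1))
        (sub_nonneg.2 (hval a ω).2) (hval a ω).1 (by ring)
      simp only [smul_eq_mul] at h
      rw [show (1 - L a ω) * S ω + L a ω * (S ω + 1) = L a ω + S ω by ring] at h
      simp only [hD]
      linarith
    rw [Finset.card_insert_of_notMem ha, sum_binomPmf_succ_mul]
    simp only [Finset.sum_insert ha]
    have hβ : 0 ≤ 1 - α := sub_nonneg.2 hα.2
    calc ∫ ω, f (L a ω + S ω) ∂μ ≤ ∫ ω, (f (S ω) + L a ω * D ω) ∂μ :=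
          integral_mono hfL (hf0.add hLD) hpoint
      _ = ∫ ω, f (S ω) ∂μ + (∫ ω, L a ω ∂μ) * ∫ ω, D ω ∂μ := by
          rw [integral_add hf0 hLD, hprod]
      _ ≤ ∫ ω, f (S ω) ∂μ + α * ∫ ω, D ω ∂μ := by
          have := mul_le_mul_of_nonpos_right (hmean a) hDneg
          linarith
      _ = ∫ ω, ((1 - α) * f (S ω) + α * f (S ω + 1)) ∂μ := by
          rw [← integral_const_mul, ← integral_add hf0 (hDint.const_mul α)]
          refine integral_congr_ae (ae_of_all _ fun ω => ?_)
          simp only [hD]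
          ring
      _ ≤ _ := by
          refine ih (f := fun x => (1 - α) * f x + α * f (x + 1)) ?_ ?_
          · exact (hconv.smul hβ).add (hshiftc.smul hα.1)
          · exact (hanti.const_mul hβ).add (hshift.const_mul hα.1)

lemma binomCdf_natCast {n k : ℕ} (hk : k ≤ n) (α : ℝ) :
    binomCdf n α k = ∑ i ∈ Finset.range (k + 1), binomPmf n α i := by
  unfold binomCdf binomPmf
  rw [← Finset.sum_filter]
  refine Finset.sum_congr ?_ fun i _ => by ring
  ext i
  simp only [Finset.mem_filter, Finset.mem_range, Nat.cast_le]
  omega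

lemma binomCdf_self (n : ℕ) (α : ℝ) : binomCdf n α n = 1 := by
  rw [binomCdf_natCast le_rfl]
  have h := add_pow α (1 - α) n
  rw [add_sub_cancel, one_pow] at h
  rw [h]
  exact Finset.sum_congr rfl fun i _ => by unfold binomPmf; ring

end Bentkus

open Bentkus in
/-- Bentkus' inequality for i.i.d. random variables in `[0,1]`: if the mean `μ[L 1]`
exceeds `α`, then for every integer `0 ≤ k ≤ n` the sum `S = ∑ L i` satisfies
`P(S ≤ k) ≤ e · P(Bin(n, α) ≤ k)`. -/
theorem bentkus_lower_tail
    {Ω : Type*} [MeasurableSpace Ω] (μ : Measure Ω) [IsProbabilityMeasure μ]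
    (n : ℕ) (hn : 0 < n) (L : Fin n → Ω → ℝ)
    (hmeas : ∀ i, Measurable (L i))
    (hval : ∀ i ω, L i ω ∈ Set.Icc (0 : ℝ) 1)
    (hindep : iIndepFun L μ)
    (hident : ∀ i, IdentDistrib (L i) (L ⟨0, hn⟩) μ μ)
    (α : ℝ) (hα : α ∈ Set.Ioo (0 : ℝ) 1)
    (hmean : μ[L ⟨0, hn⟩] > α)
    (k : ℕ) (hk : k ≤ n) :
    μ {ω | ∑ i, L i ω ≤ (k : ℝ)}
      ≤ ENNReal.ofReal (Real.exp 1 * binomCdf n α (k : ℝ)) := by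
  rcases hk.eq_or_lt with rfl | hlt
  · rw [binomCdf_self, mul_one]
    refine prob_le_one.trans ?_
    rw [← ENNReal.ofReal_one]
    exact ENNReal.ofReal_le_ofReal (one_le_exp zero_le_one)
  obtain ⟨t, hkt, ht⟩ := exists_sum_mul_max_le
    (fun i => binomPmf_nonneg (n := n) hα.1.le hα.2.le i) (binomPmf_pos hα.1 hα.2 (Nat.zero_le n))
    (fun i j hij => binomPmf_logConcave hα.1 hα.2 hij)
    (binomPmf_pos hα.1 hα.2 (Nat.succ_le_of_lt hlt)) (n + 1)
  have hconv : ConvexOn ℝ Set.univ fun x : ℝ => max (t - x) 0 :=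
    ((convexOn_const t convex_univ).sub (concaveOn_id convex_univ)).sup
      (convexOn_const 0 convex_univ)
  have hanti : Antitone fun x : ℝ => max (t - x) 0 := fun x y h => by
    dsimp only
    gcongr
  have hdom := integral_sum_le_sum_binomPmf hmeas hval hindep ⟨hα.1.le, hα.2.le⟩
    (fun i => hmean.le.trans_eq (hident i).integral_eq.symm) Finset.univ hconv hanti
  rw [Finset.card_univ, Fintype.card_fin] at hdom
  have hSm : Measurable fun ω => ∑ i, L i ω := Finset.measurable_fun_sum _ fun i _ => hmeas i
  have hint : Integrable (fun ω => max (t - ∑ i, L i ω) 0) μ := by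
    refine Integrable.of_mem_Icc 0 (max t 0)
      (hanti.measurable.comp hSm).aemeasurable (ae_of_all _ fun ω => ⟨le_max_right _ _, ?_⟩)
    have : 0 ≤ ∑ i, L i ω := Finset.sum_nonneg fun i _ => (hval i ω).1
    gcongr
    linarith
  have hmarkov := mul_meas_ge_le_integral_of_nonneg (μ := μ)
    (ae_of_all _ fun ω => le_max_right (t - ∑ i, L i ω) 0) hint (t - k)
  have hsub : {ω | ∑ i, L i ω ≤ (k : ℝ)} ⊆ {ω | t - k ≤ max (t - ∑ i, L i ω) 0} := by
    intro ω hω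
    have hω' : ∑ i, L i ω ≤ (k : ℝ) := hω
    exact (sub_le_sub_left hω' t).trans (le_max_left _ _)
  have hreal : μ.real {ω | ∑ i, L i ω ≤ (k : ℝ)} ≤ exp 1 * binomCdf n α k := by
    rw [binomCdf_natCast hk]
    refine le_of_mul_le_mul_left ?_ (sub_pos.2 hkt)
    calc _ ≤ (t - k) * μ.real {ω | t - k ≤ max (t - ∑ i, L i ω) 0} :=
          mul_le_mul_of_nonneg_left (measureReal_mono hsub) (sub_pos.2 hkt).le
      _ ≤ _ := hmarkov.trans (hdom.trans ht)
  rw [← ofReal_measureReal]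
  exact ENNReal.ofReal_le_ofReal hreal
end
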